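/- arXiv:1802.08828 — 3 statements merged into one kernel-verified Lean document; each statement's English description precedes it below -/
import Mathlib

section
/- Let n ≥ 1 and c : Fin n → ℤ with c i ≠ 0 for every i. Then the orbit space ℂ^n / T'_c of the restricted coordinatewise action of the kernel subgroup T'_c = ker χ_c on ℂ^n = (Fin n → ℂ) is homeomorphic to the Euclidean space ℝ^{n+1} = (Fin (n+1) → ℝ). -/
open scoped BigOperators

noncomputable def torusChar {n : ℕ} (c : Fin n → ℤ) : (Fin n → Circle) →* Circle where
  toFun t := ∏ i, t i ^ c i
  map_one' := by simp
  map_mul' a b := by simp [mul_zpow, Finset.prod_mul_distrib]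

noncomputable def torusKer {n : ℕ} (c : Fin n → ℤ) : Subgroup (Fin n → Circle) :=
  (torusChar c).ker

theorem Circle.exists_zpow_eq {k : ℤ} (hk : k ≠ 0) (w : Circle) : ∃ s : Circle, s ^ k = w := by
  refine ⟨Circle.exp (Complex.arg w / k), ?_⟩
  rw [← Circle.exp_zsmul, zsmul_eq_mul, mul_div_cancel₀ _ (by exact_mod_cast hk), Circle.exp_arg]

theorem Circle.exists_smul_eq_of_norm_eq {a b : ℂ} (h : ‖a‖ = ‖b‖) : ∃ t : Circle, t • a = b := by
  by_cases ha : a = 0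
  · subst ha
    exact ⟨1, by simpa [eq_comm] using h⟩
  · refine ⟨⟨b / a, ?_⟩, ?_⟩
    · change b / a ∈ Metric.sphere (0 : ℂ) 1
      rw [mem_sphere_zero_iff_norm, norm_div, h, div_self (by rw [← h]; simpa using ha)]
    · exact div_mul_cancel₀ b ha

theorem torusChar_mulSingle {n : ℕ} (c : Fin n → ℤ) (j : Fin n) (s : Circle) :
    torusChar c (Pi.mulSingle j s) = s ^ c j := by
  change ∏ i, (Pi.mulSingle j s : Fin n → Circle) i ^ c i = _
  rw [Finset.prod_eq_single j] <;> simp +contextual [Pi.mulSingle_eq_of_ne]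

/-- The smallest modulus among the coordinates of a vector. -/
noncomputable def minNorm {m : ℕ} (z : Fin (m + 1) → ℂ) : ℝ :=
  Finset.univ.inf' Finset.univ_nonempty fun i => ‖z i‖

/-- The product of the phases `z i / |z i|` to the powers `c i`, scaled to have modulus
`minNorm z`. -/
noncomputable def phaseInvariant {m : ℕ} (c : Fin (m + 1) → ℤ) (z : Fin (m + 1) → ℂ) : ℂ :=
  minNorm z * ∏ i, (z i / ‖z i‖) ^ c i

section Invariants

variable {m : ℕ} (c : Fin (m + 1) → ℤ)

theorem minNorm_nonneg (z : Fin (m + 1) → ℂ) : 0 ≤ minNorm z :=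
  Finset.le_inf' _ _ fun _ _ => norm_nonneg _

theorem minNorm_le (z : Fin (m + 1) → ℂ) (i : Fin (m + 1)) : minNorm z ≤ ‖z i‖ :=
  Finset.inf'_le _ (Finset.mem_univ i)

theorem exists_minNorm_eq (z : Fin (m + 1) → ℂ) : ∃ j, minNorm z = ‖z j‖ := by
  obtain ⟨j, -, hj⟩ := Finset.exists_mem_eq_inf' Finset.univ_nonempty fun i => ‖z i‖
  exact ⟨j, hj⟩

theorem minNorm_eq_zero_iff {z : Fin (m + 1) → ℂ} : minNorm z = 0 ↔ ∃ j, z j = 0 := by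
  refine ⟨fun h => ?_, fun ⟨j, hj⟩ => ?_⟩
  · obtain ⟨j, hj⟩ := exists_minNorm_eq z
    exact ⟨j, by rw [← norm_eq_zero, ← hj, h]⟩
  · exact le_antisymm (by simpa [hj] using minNorm_le z j) (minNorm_nonneg z)

theorem continuous_minNorm : Continuous (minNorm : (Fin (m + 1) → ℂ) → ℝ) :=
  Continuous.finset_inf'_apply _ fun i _ => (continuous_apply i).norm

theorem norm_phaseInvariant (z : Fin (m + 1) → ℂ) : ‖phaseInvariant c z‖ = minNorm z := by
  rw [phaseInvariant, norm_mul, Complex.norm_real, Real.norm_of_nonneg (minNorm_nonneg z)]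
  by_cases h : minNorm z = 0
  · simp [h]
  · have hz : ∀ i, z i ≠ 0 := by simpa [minNorm_eq_zero_iff] using h
    simp [hz]

theorem continuous_phaseInvariant : Continuous (phaseInvariant c) := by
  rw [continuous_iff_continuousAt]
  intro z
  by_cases h : minNorm z = 0
  · have hz : phaseInvariant c z = 0 := by rw [← norm_eq_zero, norm_phaseInvariant, h]
    rw [ContinuousAt, hz, tendsto_zero_iff_norm_tendsto_zero]
    simp only [norm_phaseInvariant]
    simpa [h] using (continuous_minNorm (m := m)).tendsto z
  · have hz : ∀ i, z i ≠ 0 := by simpa [minNorm_eq_zero_iff] using h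
    refine ContinuousAt.mul (Complex.continuous_ofReal.comp continuous_minNorm).continuousAt ?_
    refine tendsto_finsetProd _ fun i _ => ?_
    have hi : ContinuousAt (fun y : Fin (m + 1) → ℂ => y i) z := (continuous_apply i).continuousAt
    refine ContinuousAt.zpow₀ ?_ _ (Or.inl (by simp [hz i]))
    exact hi.div (Complex.continuous_ofReal.continuousAt.comp hi.norm) (by simp [hz i])

theorem phaseInvariant_smul (t : Fin (m + 1) → Circle) (z : Fin (m + 1) → ℂ) :
    phaseInvariant c (t • z) = torusChar c t * phaseInvariant c z := by
  have hχ : ((torusChar c t : Circle) : ℂ) = ∏ i, (t i : ℂ) ^ c i := by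
    change Circle.coeHom (∏ i, t i ^ c i) = _
    simp only [map_prod, map_zpow]
    rfl
  simp only [phaseInvariant, minNorm, Pi.smul_apply', Circle.smul_def, smul_eq_mul, norm_mul,
    Circle.norm_coe, one_mul, mul_div_assoc, mul_zpow, Finset.prod_mul_distrib, hχ]
  ring

/-- A complete set of continuous invariants of the action of `torusKer c`. -/
noncomputable def orbitInvariant (z : Fin (m + 1) → ℂ) : (Fin m → ℝ) × ℂ :=
  (fun i => ‖z i.succ‖ - ‖z 0‖, phaseInvariant c z)

theorem continuous_orbitInvariant : Continuous (orbitInvariant c) := by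
  have := continuous_phaseInvariant c
  unfold orbitInvariant
  fun_prop

theorem norm_eq_of_orbitInvariant_eq {y z : Fin (m + 1) → ℂ}
    (h : orbitInvariant c y = orbitInvariant c z) (i : Fin (m + 1)) : ‖y i‖ = ‖z i‖ := by
  obtain ⟨hd, hw⟩ := Prod.ext_iff.mp h
  have hmin : minNorm y = minNorm z := by
    rw [← norm_phaseInvariant c, ← norm_phaseInvariant c]
    exact congrArg norm hw
  have hdiff : ∀ i, ‖y i‖ - ‖y 0‖ = ‖z i‖ - ‖z 0‖ :=
    Fin.cases (by simp) fun i => congrFun hd i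
  obtain ⟨j, hj⟩ := exists_minNorm_eq y
  obtain ⟨k, hk⟩ := exists_minNorm_eq z
  linarith [minNorm_le y k, minNorm_le z j, hdiff i, hdiff j, hdiff k]

theorem orbitInvariant_eq_iff (hc : ∀ i, c i ≠ 0) (y z : Fin (m + 1) → ℂ) :
    orbitInvariant c y = orbitInvariant c z ↔ y ∈ MulAction.orbit (torusKer c) z := by
  constructor
  · intro h
    choose t ht using fun i =>
      Circle.exists_smul_eq_of_norm_eq (norm_eq_of_orbitInvariant_eq c h i).symm
    have hty : t • z = y := funext ht
    have hW : (torusChar c t : ℂ) * phaseInvariant c z = phaseInvariant c z := by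
      rw [← phaseInvariant_smul, hty]
      exact congrArg Prod.snd h
    by_cases hz : minNorm z = 0
    · obtain ⟨j, hj⟩ := minNorm_eq_zero_iff.mp hz
      obtain ⟨s, hs⟩ := Circle.exists_zpow_eq (hc j) (torusChar c t)⁻¹
      refine ⟨⟨t * Pi.mulSingle j s, ?_⟩, ?_⟩
      · rw [torusKer, MonoidHom.mem_ker, map_mul, torusChar_mulSingle, hs, mul_inv_cancel]
      · change (t * Pi.mulSingle j s) • z = y
        have hfix : (Pi.mulSingle j s : Fin (m + 1) → Circle) • z = z := by
          ext i
          by_cases hi : i = j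
          · subst hi
            simp [hj]
          · simp [Pi.mulSingle_eq_of_ne hi]
        rw [mul_smul, hfix, hty]
    · refine ⟨⟨t, ?_⟩, hty⟩
      rw [torusKer, MonoidHom.mem_ker]
      refine Circle.ext (mul_right_cancel₀ (b := phaseInvariant c z) ?_ (by simpa using hW))
      rwa [← norm_ne_zero_iff, norm_phaseInvariant]
  · rintro ⟨⟨t, ht⟩, rfl⟩
    change orbitInvariant c (t • z) = _
    rw [torusKer, MonoidHom.mem_ker] at ht
    simp [orbitInvariant, phaseInvariant_smul, ht, Circle.norm_smul]

theorem surjective_orbitInvariant (hc : ∀ i, c i ≠ 0) :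
    Function.Surjective (orbitInvariant c) := by
  rintro ⟨d, w⟩
  let e : Fin (m + 1) → ℝ := Fin.cons 0 d
  obtain ⟨j, hj⟩ := Finite.exists_min e
  let r : Fin (m + 1) → ℂ := fun i => ((e i - e j + ‖w‖ : ℝ) : ℂ)
  have hr : ∀ i, ‖r i‖ = e i - e j + ‖w‖ := fun i => by
    rw [Complex.norm_real, Real.norm_of_nonneg]
    linarith [hj i, norm_nonneg w]
  have hmin : minNorm r = ‖w‖ := by
    refine le_antisymm ((minNorm_le r j).trans_eq (by simp [hr])) (Finset.le_inf' _ _ fun i _ => ?_)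
    rw [hr]
    linarith [hj i]
  obtain ⟨u, hu⟩ := Circle.exists_smul_eq_of_norm_eq
    (a := phaseInvariant c r) (b := w) (by rw [norm_phaseInvariant, hmin])
  obtain ⟨s, hs⟩ := Circle.exists_zpow_eq (hc 0) u
  refine ⟨(Pi.mulSingle 0 s : Fin (m + 1) → Circle) • r, Prod.ext (funext fun i => ?_) ?_⟩
  · simp [orbitInvariant, Circle.norm_smul, hr, e]
  · simpa [orbitInvariant, phaseInvariant_smul, torusChar_mulSingle, hs, Circle.smul_def] using hu

theorem norm_le_three_mul_norm_orbitInvariant (z : Fin (m + 1) → ℂ) :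
    ‖z‖ ≤ 3 * ‖orbitInvariant c z‖ := by
  refine (pi_norm_le_iff_of_nonneg (by positivity)).mpr fun i => ?_
  have hd : ∀ i, |‖z i‖ - ‖z 0‖| ≤ ‖orbitInvariant c z‖ :=
    Fin.cases (by simp) fun i =>
      (norm_le_pi_norm (orbitInvariant c z).1 i).trans (norm_fst_le _)
  have hw : minNorm z ≤ ‖orbitInvariant c z‖ :=
    (norm_phaseInvariant c z).symm.trans_le (norm_snd_le (orbitInvariant c z))
  obtain ⟨j, hj⟩ := exists_minNorm_eq z
  linarith [(abs_le.mp (hd i)).2, (abs_le.mp (hd j)).1]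

theorem isProperMap_orbitInvariant : IsProperMap (orbitInvariant c) := by
  refine isProperMap_iff_isCompact_preimage.mpr ⟨continuous_orbitInvariant c, fun K hK => ?_⟩
  obtain ⟨R, hR⟩ := hK.isBounded.exists_norm_le
  refine Metric.isCompact_of_isClosed_isBounded
    (hK.isClosed.preimage (continuous_orbitInvariant c))
    (isBounded_iff_forall_norm_le.mpr ⟨3 * R, fun z hz => ?_⟩)
  linarith [norm_le_three_mul_norm_orbitInvariant c z, hR _ hz]

theorem isQuotientMap_orbitInvariant (hc : ∀ i, c i ≠ 0) :
    Topology.IsQuotientMap (orbitInvariant c) :=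
  (isProperMap_orbitInvariant c).isClosedMap.isQuotientMap (continuous_orbitInvariant c)
    (surjective_orbitInvariant c hc)

theorem orbitRel_torusKer_eq_ker (hc : ∀ i, c i ≠ 0) :
    MulAction.orbitRel (torusKer c) (Fin (m + 1) → ℂ) = Setoid.ker (orbitInvariant c) :=
  Setoid.ext fun y z => (orbitInvariant_eq_iff c hc y z).symm

end Invariants

theorem orbit_space_of_kernel_subtorus_homeomorph_euclidean
    (n : ℕ) (hn : 1 ≤ n) (c : Fin n → ℤ) (hc : ∀ i, c i ≠ 0) :
    Nonempty (Quotient (MulAction.orbitRel ↥(torusKer c) (Fin n → ℂ)) ≃ₜ (Fin (n + 1) → ℝ)) := by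
  obtain ⟨m, rfl⟩ := Nat.exists_eq_add_of_le' hn
  rw [orbitRel_torusKer_eq_ker c hc]
  refine ⟨(Topology.IsQuotientMap.homeomorph
    (f := ⟨orbitInvariant c, continuous_orbitInvariant c⟩)
    (isQuotientMap_orbitInvariant c hc)).trans
    (ContinuousLinearEquiv.ofFinrankEq (𝕜 := ℝ) ?_).toHomeomorph⟩
  simp [Complex.finrank_real_complex]
end

section
/- For c : Fin n → ℤ with c ≠ 0, the kernel subgroup T'_c of χ_c, with its subspace topology in T^n, has exactly gcd_i |c i| connected components (i.e., the space of connected components of T'_c is finite of cardinality gcd_{i ∈ Fin n} |c i|). In particular, T'_c is connected if and only if gcd_i |c i| = 1. -/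
open scoped BigOperators

theorem Finset.natCast_gcd_natAbs {ι : Type*} (s : Finset ι) (c : ι → ℤ) :
    ((s.gcd fun i => (c i).natAbs : ℕ) : ℤ) = s.gcd c := by
  classical
  induction s using Finset.induction_on with
  | empty => simp
  | insert a s _ ih =>
    rw [Finset.gcd_insert, Finset.gcd_insert, ← ih, ← Int.coe_gcd]
    rfl

/-- A continuous surjection onto a totally disconnected space whose fibres are preconnected
identifies its target with the space of connected components of its source. -/
theorem Continuous.connectedComponentsLift_bijective {X Y : Type*} [TopologicalSpace X]
    [TopologicalSpace Y] [TotallyDisconnectedSpace Y] {f : X → Y} (hf : Continuous f)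
    (hs : Function.Surjective f) (hc : ∀ y, IsPreconnected (f ⁻¹' {y})) :
    Function.Bijective hf.connectedComponentsLift := by
  refine ⟨fun a b hab => ?_, fun y => ?_⟩
  · induction a, b using Quotient.inductionOn₂ with | _ x y =>
    exact ConnectedComponents.coe_eq_coe'.2 <|
      (hc (f y)).subset_connectedComponent rfl (show f x = f y from hab)
  · obtain ⟨x, rfl⟩ := hs y
    exact ⟨x, rfl⟩

theorem torusChar_apply {n : ℕ} (c : Fin n → ℤ) (t : Fin n → Circle) :
    torusChar c t = ∏ i, t i ^ c i := rfl

theorem continuous_torusChar {n : ℕ} (c : Fin n → ℤ) : Continuous (torusChar c) :=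
  continuous_finsetProd Finset.univ fun i _ =>
    (continuous_zpow (c i)).comp (continuous_apply i)

theorem torusChar_mul_left {n : ℕ} (d : ℕ) (c : Fin n → ℤ) (t : Fin n → Circle) :
    torusChar (fun i => d * c i) t = torusChar c t ^ d := by
  simp_rw [torusChar_apply, ← Finset.prod_pow]
  refine Finset.prod_congr rfl fun i _ => ?_
  rw [mul_comm, zpow_mul, zpow_natCast]

theorem torusChar_exp {n : ℕ} (c : Fin n → ℤ) (θ : Fin n → ℝ) :
    torusChar c (fun i => Circle.exp (θ i)) = Circle.exp (∑ i, c i * θ i) := by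
  simp_rw [torusChar_apply, ← zsmul_eq_mul, ← Circle.exp_zsmul]
  exact (map_sum Circle.expHom _ _).symm

theorem torusChar_zpow {n : ℕ} (c b : Fin n → ℤ) (z : Circle) :
    torusChar c (fun i => z ^ b i) = z ^ ∑ i, c i * b i := by
  obtain ⟨x, rfl⟩ := Circle.exp_surjective z
  simp_rw [← Circle.exp_zsmul, torusChar_exp, zsmul_eq_mul]
  push_cast
  rw [Finset.sum_mul]
  simp_rw [mul_assoc]

/-- The fibres of the character of a primitive vector are preconnected: each is the image of
an affine hyperplane under the exponential map. -/
theorem isPreconnected_torusChar_preimage {n : ℕ} {c b : Fin n → ℤ} (h : ∑ i, c i * b i = 1)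
    (z : Circle) : IsPreconnected (torusChar c ⁻¹' {z}) := by
  obtain ⟨α, rfl⟩ := Circle.exp_surjective z
  have hconv : Convex ℝ {θ : Fin n → ℝ | ∑ i, c i * θ i = α} := by
    refine convex_hyperplane ⟨fun x y => ?_, fun r x => ?_⟩ α
    · simp [mul_add, Finset.sum_add_distrib]
    · simp [Finset.mul_sum, mul_left_comm]
  convert hconv.isPreconnected.image (fun θ i => Circle.exp (θ i)) (by fun_prop) using 1
  ext t
  constructor
  · intro ht
    choose θ hθ using fun i => Circle.exp_surjective (t i)
    obtain rfl : (fun i => Circle.exp (θ i)) = t := funext hθ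
    rw [Set.mem_preimage, Set.mem_singleton_iff, torusChar_exp, Circle.exp_eq_exp] at ht
    obtain ⟨k, hk⟩ := ht
    refine ⟨fun i => θ i - (k * b i : ℤ) * (2 * Real.pi), ?_, ?_⟩
    · have h' : ∑ i, (c i : ℝ) * b i = 1 := by exact_mod_cast h
      have : ∑ i, (c i : ℝ) * (θ i - (k * b i : ℤ) * (2 * Real.pi)) =
          ∑ i, c i * θ i - (∑ i, (c i : ℝ) * b i) * (k * (2 * Real.pi)) := by
        rw [Finset.sum_mul, ← Finset.sum_sub_distrib]
        refine Finset.sum_congr rfl fun i _ => ?_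
        push_cast
        ring
      rw [Set.mem_ofPred_eq, this, h', hk]
      ring
    · funext i
      exact Circle.exp_eq_exp.2 ⟨-(k * b i), by push_cast; ring⟩
  · rintro ⟨θ, hθ, rfl⟩
    rw [Set.mem_preimage, Set.mem_singleton_iff, torusChar_exp, hθ]

theorem Finset.exists_eq_gcd_natAbs_mul {ι : Type*} (s : Finset ι) {c : ι → ℤ}
    (hs : s.gcd (fun i => (c i).natAbs) ≠ 0) :
    ∃ c' b : ι → ℤ, (∀ i ∈ s, c i = (s.gcd fun i => (c i).natAbs : ℕ) * c' i) ∧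
      ∑ i ∈ s, c' i * b i = 1 := by
  have hne : s.Nonempty := by
    rw [Finset.nonempty_iff_ne_empty]
    rintro rfl
    simp at hs
  obtain ⟨c', hc', hgcd⟩ := s.extract_gcd c hne
  obtain ⟨b, hb⟩ := s.gcd_eq_sum_mul c'
  refine ⟨c', b, by rwa [s.natCast_gcd_natAbs], ?_⟩
  rw [← hgcd, hb]

theorem nonempty_connectedComponents_torusKer_equiv {n : ℕ} {c b : Fin n → ℤ}
    (h : ∑ i, c i * b i = 1) (d : ℕ) [NeZero d] :
    Nonempty (ConnectedComponents (torusKer fun i => d * c i) ≃ rootsOfUnity d Circle) := by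
  let f : torusKer (fun i => d * c i) → rootsOfUnity d Circle := fun t =>
    rootsOfUnity.mkOfPowEq (torusChar c t) <| by
      rw [← torusChar_mul_left]
      exact t.2
  have hcont : Continuous fun t : torusKer (fun i => d * c i) => torusChar c t :=
    (continuous_torusChar c).comp continuous_subtype_val
  have hf : Continuous f := by
    refine Continuous.subtype_mk (Units.continuous_iff.2 ⟨hcont, ?_⟩) _
    convert hcont.inv using 2 with t
    exact eq_inv_of_mul_eq_one_left (Units.inv_mul (f t : Circleˣ))
  refine ⟨Equiv.ofBijective _ (hf.connectedComponentsLift_bijective (fun ζ => ?_) fun ζ => ?_)⟩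
  · have hζ : torusChar c (fun i => ((ζ : Circleˣ) : Circle) ^ b i) = (ζ : Circleˣ) := by
      rw [torusChar_zpow, h, zpow_one]
    refine ⟨⟨fun i => ((ζ : Circleˣ) : Circle) ^ b i, ?_⟩, ?_⟩
    · rw [torusKer, MonoidHom.mem_ker, torusChar_mul_left, hζ]
      exact (mem_rootsOfUnity' d _).1 ζ.2
    · exact Subtype.ext (Units.ext hζ)
  · rw [← Topology.IsInducing.subtypeVal.isPreconnected_image]
    convert isPreconnected_torusChar_preimage h ((ζ : Circleˣ) : Circle) using 1
    ext t
    constructor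
    · rintro ⟨t, ht, rfl⟩
      exact congrArg (fun ζ : rootsOfUnity d Circle => ((ζ : Circleˣ) : Circle)) ht
    · intro ht
      refine ⟨⟨t, ?_⟩, Subtype.ext (Units.ext ht), rfl⟩
      rw [torusKer, SetLike.mem_coe, MonoidHom.mem_ker, torusChar_mul_left, Set.mem_singleton_iff.1 ht]
      exact (mem_rootsOfUnity' d _).1 ζ.2

theorem connectedSpace_iff_card_connectedComponents_eq_one {X : Type*} [TopologicalSpace X] :
    ConnectedSpace X ↔ Nat.card (ConnectedComponents X) = 1 := by
  rw [Nat.card_eq_one_iff_unique]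
  constructor
  · intro _
    exact ⟨inferInstance, inferInstance⟩
  · rintro ⟨_, ⟨a⟩⟩
    obtain ⟨x, rfl⟩ := ConnectedComponents.surjective_coe a
    refine connectedSpace_iff_connectedComponent.2 ⟨x, Set.eq_univ_of_forall fun y => ?_⟩
    exact ConnectedComponents.coe_eq_coe'.1 (Subsingleton.elim _ _)

/-- for `c ≠ 0`, the subgroup `T'_c ⊆ T^n` has exactly `gcd_i |c i|`
connected components; in particular it is connected iff `gcd_i |c i| = 1`. -/
theorem torusKer_connectedComponents_card_eq_gcd
    (n : ℕ) (c : Fin n → ℤ) (hc : c ≠ 0) :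
    Finite (ConnectedComponents ↥(torusKer c)) ∧
      Nat.card (ConnectedComponents ↥(torusKer c))
        = Finset.univ.gcd (fun i => (c i).natAbs) ∧
      (ConnectedSpace ↥(torusKer c) ↔ Finset.univ.gcd (fun i => (c i).natAbs) = 1) := by
  have hd : Finset.univ.gcd (fun i => (c i).natAbs) ≠ 0 := fun h =>
    hc <| funext fun i => Int.natAbs_eq_zero.1 (Finset.gcd_eq_zero_iff.1 h i (Finset.mem_univ i))
  obtain ⟨c', b, hc', hb⟩ := Finset.univ.exists_eq_gcd_natAbs_mul hd
  generalize Finset.univ.gcd (fun i => (c i).natAbs) = d at *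
  obtain rfl : c = fun i => d * c' i := funext fun i => hc' i (Finset.mem_univ i)
  have : NeZero d := ⟨hd⟩
  obtain ⟨e⟩ := nonempty_connectedComponents_torusKer_equiv hb d
  have hcard := (Nat.card_congr e).trans (HasEnoughRootsOfUnity.natCard_rootsOfUnity Circle d)
  exact ⟨.of_equiv _ e.symm, hcard, by
    rw [connectedSpace_iff_card_connectedComponents_eq_one, hcard]⟩
end

section
/- Let n ≥ 1. There exists a homeomorphism h from the nonnegative quadrant {x : Fin n → ℝ | ∀ i, 0 ≤ x i} (with subspace topology from Fin n → ℝ) onto the product (Fin (n-1) → ℝ) × {r : ℝ | 0 ≤ r} such that h maps the boundary set {x | ∃ i, x i = 0} onto (Fin (n-1) → ℝ) × {0}. -/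
/-- The smallest coordinate of a vector. -/
noncomputable def minCoord {m : ℕ} (x : Fin (m + 1) → ℝ) : ℝ :=
  Finset.univ.inf' Finset.univ_nonempty x

lemma continuous_minCoord {m : ℕ} :
    Continuous (minCoord : (Fin (m + 1) → ℝ) → ℝ) :=
  Continuous.finset_inf'_apply _ fun i _ => continuous_apply i

lemma minCoord_le {m : ℕ} (x : Fin (m + 1) → ℝ) (i : Fin (m + 1)) : minCoord x ≤ x i :=
  Finset.inf'_le _ (Finset.mem_univ i)

lemma exists_eq_minCoord {m : ℕ} (x : Fin (m + 1) → ℝ) : ∃ i, x i = minCoord x := by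
  obtain ⟨i, -, hi⟩ := Finset.exists_mem_eq_inf' Finset.univ_nonempty x
  exact ⟨i, hi.symm⟩

lemma minCoord_add_const {m : ℕ} (x : Fin (m + 1) → ℝ) (c : ℝ) :
    minCoord (fun i => x i + c) = minCoord x + c := by
  obtain ⟨i, hi⟩ := exists_eq_minCoord x
  obtain ⟨j, hj⟩ := exists_eq_minCoord fun i => x i + c
  have hle := minCoord_le (fun i => x i + c) i
  have hge := minCoord_le x j
  linarith

/-- The homeomorphism from the nonnegative quadrant to the half-space that records the differences
of the coordinates to the first one, together with the smallest coordinate. -/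
noncomputable def quadrantHomeomorphHalfspace (m : ℕ) :
    {x : Fin (m + 1) → ℝ // ∀ i, 0 ≤ x i} ≃ₜ (Fin m → ℝ) × {r : ℝ // 0 ≤ r} where
  toFun x := (fun i => x.1 i.succ - x.1 0, ⟨minCoord x.1, by
    obtain ⟨i, hi⟩ := exists_eq_minCoord x.1
    exact hi ▸ x.2 i⟩)
  invFun p := ⟨fun i => (Fin.cons 0 p.1 : Fin (m + 1) → ℝ) i +
      (p.2 - minCoord (Fin.cons 0 p.1 : Fin (m + 1) → ℝ)), fun i => by
    have := minCoord_le (Fin.cons 0 p.1 : Fin (m + 1) → ℝ) i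
    have := p.2.2
    linarith⟩
  left_inv x := by
    have h : (Fin.cons 0 fun i => x.1 i.succ - x.1 0 : Fin (m + 1) → ℝ) =
        fun i => x.1 i + -x.1 0 := by
      ext i
      cases i using Fin.cases <;> simp [sub_eq_add_neg]
    ext i
    simp only [h, minCoord_add_const]
    ring
  right_inv p := by
    ext i
    · simp
    · simp only [minCoord_add_const]
      ring
  continuous_toFun := by
    have h (i : Fin (m + 1)) :
        Continuous fun x : {x : Fin (m + 1) → ℝ // ∀ i, 0 ≤ x i} => x.1 i :=
      (continuous_apply i).comp continuous_subtype_val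
    exact .prodMk (continuous_pi fun i => (h i.succ).sub (h 0))
      (.subtype_mk (continuous_minCoord.comp continuous_subtype_val) _)
  continuous_invFun := by
    have := continuous_minCoord (m := m)
    have h : Continuous fun p : (Fin m → ℝ) × {r : ℝ // 0 ≤ r} =>
        (Fin.cons 0 p.1 : Fin (m + 1) → ℝ) := by
      refine continuous_pi fun i => ?_
      cases i using Fin.cases <;> simp only [Fin.cons_zero, Fin.cons_succ] <;> fun_prop
    fun_prop

/-- a corner-straightening homeomorphism
`(ℝ_{≥0}^n, ∂ℝ_{≥0}^n) ≅ (ℝ^{n-1} × ℝ_{≥0}, ℝ^{n-1} × {0})`. -/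
theorem quadrant_homeomorph_halfspace_preserving_boundary
    (n : ℕ) (hn : 1 ≤ n) :
    ∃ h : {x : Fin n → ℝ // ∀ i, 0 ≤ x i} ≃ₜ (Fin (n - 1) → ℝ) × {r : ℝ // 0 ≤ r},
      ∀ x : {x : Fin n → ℝ // ∀ i, 0 ≤ x i},
        (∃ i, (x : Fin n → ℝ) i = 0) ↔ ((h x).2 : ℝ) = 0 := by
  obtain ⟨m, rfl⟩ : ∃ m, n = m + 1 := ⟨n - 1, by omega⟩
  refine ⟨quadrantHomeomorphHalfspace m, fun x => ?_⟩
  change _ ↔ minCoord x.1 = 0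
  obtain ⟨j, hj⟩ := exists_eq_minCoord x.1
  exact ⟨fun ⟨i, hi⟩ => le_antisymm ((minCoord_le x.1 i).trans_eq hi) ((x.2 j).trans_eq hj),
    fun h => ⟨j, hj.trans h⟩⟩
end
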